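/- For every t > 0, θ > 0 and 0 ≤ p₁ < p₂ < 1, the zero-inflated negative binomial variables of the second kind satisfy Z₂(t,θ,p₁) ≤cx Z₂(t,θ,p₂). -/

import Mathlib

open MeasureTheory Filter Topology ProbabilityTheory

noncomputable section

/-- `ConvexOrder μ ν` means the distribution `μ` is dominated by `ν` in the convex order:
`∫ φ dμ ≤ ∫ φ dν` for every convex function `φ : ℝ → ℝ` for which both integrals are
well defined. -/
def ConvexOrder (μ ν : Measure ℝ) : Prop :=
  ∀ φ : ℝ → ℝ, ConvexOn ℝ Set.univ φ → Integrable φ μ → Integrable φ ν →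
    ∫ x, φ x ∂μ ≤ ∫ x, φ x ∂ν

/-- The discrete measure on `ℝ` supported on the nonnegative integers with weights `w k`. -/
def discreteMeasure (w : ℕ → ℝ) : Measure ℝ :=
  Measure.sum fun k => ENNReal.ofReal (w k) • Measure.dirac (k : ℝ)

/-- The Poisson probabilities with mean `θ`. -/
def poissonPMFReal (θ : ℝ) (k : ℕ) : ℝ := Real.exp (-θ) * θ ^ k / k.factorial

/-- The Poisson distribution with mean `θ`, as a measure on `ℝ`. -/
def poissonMeasure (θ : ℝ) : Measure ℝ := discreteMeasure (poissonPMFReal θ)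

/-- The binomial probabilities with parameters `m` and `q`. -/
def binomialPMFReal (m : ℕ) (q : ℝ) (k : ℕ) : ℝ :=
  (m.choose k) * q ^ k * (1 - q) ^ (m - k)

/-- The binomial distribution with parameters `m` and `q`, as a measure on `ℝ`. -/
def binomialMeasure (m : ℕ) (q : ℝ) : Measure ℝ := discreteMeasure (binomialPMFReal m q)

/-- The negative binomial probabilities: `P(Z(t,θ) = k) =
(Γ(k + 1/t)/(k! Γ(1/t))) (θt)^k / (1 + θt)^(k + 1/t)`; this distribution has mean `θ`. -/
def negBinomialPMFReal (t θ : ℝ) (k : ℕ) : ℝ :=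
  Real.Gamma (k + 1 / t) / (k.factorial * Real.Gamma (1 / t)) * (θ * t) ^ k /
    (1 + θ * t) ^ ((k : ℝ) + 1 / t)

/-- The negative binomial distribution `Z(t,θ)`, as a measure on `ℝ`. -/
def negBinomialMeasure (t θ : ℝ) : Measure ℝ := discreteMeasure (negBinomialPMFReal t θ)

/-- Zero inflation: the mixture of the point mass at `0` with weight `p` and `μ` with
weight `1 - p`. -/
def ziMeasure (p : ℝ) (μ : Measure ℝ) : Measure ℝ :=
  ENNReal.ofReal p • Measure.dirac (0 : ℝ) + ENNReal.ofReal (1 - p) • μ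

/-- The zero-inflated Poisson distribution `Y(θ,p)`: mixture of the point mass at `0` with
weight `p` and the Poisson distribution with mean `θ/(1-p)` with weight `1-p`. -/
def ZIP (θ p : ℝ) : Measure ℝ := ziMeasure p (poissonMeasure (θ / (1 - p)))

/-- The zero-inflated binomial distribution `X(m,θ,p)`: mixture of the point mass at `0` with
weight `p` and the binomial distribution with parameters `m` and `θ/(m(1-p))` with
weight `1-p`. -/
def ZIB (m : ℕ) (θ p : ℝ) : Measure ℝ :=
  ziMeasure p (binomialMeasure m (θ / (m * (1 - p))))

/-- The zero-inflated negative binomial distribution of the first kind `Z₁(t,θ,p)`: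
mixture of the point mass at `0` with weight `p` and `Z(t(1-p), θ/(1-p))` with weight `1-p`. -/
def ZINB₁ (t θ p : ℝ) : Measure ℝ :=
  ziMeasure p (negBinomialMeasure (t * (1 - p)) (θ / (1 - p)))

/-- The zero-inflated negative binomial distribution of the second kind `Z₂(t,θ,p)`:
mixture of the point mass at `0` with weight `p` and `Z(t, θ/(1-p))` with weight `1-p`. -/
def ZINB₂ (t θ p : ℝ) : Measure ℝ :=
  ziMeasure p (negBinomialMeasure t (θ / (1 - p)))

/-- The probability mass function of the zero-inflated negative binomial
distribution `Z₂(t,θ,p)`. -/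
def zinb2PMFReal (t θ p : ℝ) (k : ℕ) : ℝ :=
  (if k = 0 then p else 0) + (1 - p) * negBinomialPMFReal t (θ / (1 - p)) k

/-- The expected value of the maximum of `k` independent copies of a random variable with
distribution `μ`. -/
def expMax (μ : Measure ℝ) (k : ℕ) : ℝ :=
  ∫ x : Fin k → ℝ, (⨆ i, x i) ∂(Measure.pi fun _ => μ)

/-- The expected value of the minimum of `k` independent copies of a random variable with
distribution `μ`. -/
def expMin (μ : Measure ℝ) (k : ℕ) : ℝ :=
  ∫ x : Fin k → ℝ, (⨅ i, x i) ∂(Measure.pi fun _ => μ)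

/-- The modified Bessel function of the first kind of integer order `n`. -/
def besselI (n : ℕ) (x : ℝ) : ℝ :=
  ∑' j : ℕ, (x / 2) ^ (2 * j + n) / (j.factorial * (j + n).factorial)

/-- `M₂ θ`: the expected value of the maximum of two independent Poisson random variables
with mean `θ`. -/
def M₂ (x : ℝ) : ℝ := x + x * Real.exp (-2 * x) * (besselI 0 (2 * x) + besselI 1 (2 * x))

/-- The discrepancy `Δ₂:₂(θ,p) = 2pθ + (1-p)² M₂(θ/(1-p)) − M₂(θ)`. -/
def Δdisc (θ p : ℝ) : ℝ := 2 * p * θ + (1 - p) ^ 2 * M₂ (θ / (1 - p)) - M₂ θ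

/-- The asymptotic variance `σ²(θ)` of `√n Δ₂:₂` under the Poisson null hypothesis. -/
def σsq (θ : ℝ) : ℝ :=
  θ ^ 2 * (1 - Real.exp (-2 * θ) *
      ((1 + θ) * besselI 0 (2 * θ) - besselI 1 (2 * θ) + θ * besselI 2 (2 * θ))) ^ 2 /
    (Real.exp θ - 1 - θ)


theorem Real.ascPochhammer_eval_eq_Gamma_div {r : ℝ} (hr : 0 < r) (n : ℕ) :
    (ascPochhammer ℝ n).eval r = Real.Gamma (n + r) / Real.Gamma r := by
  have h := (Real.Gamma_pos_of_pos hr).ne'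
  induction n with
  | zero => simp [h]
  | succ n ih =>
    have hn : (n : ℝ) + r ≠ 0 := by positivity
    have : ((n + 1 : ℕ) : ℝ) + r = (n + r) + 1 := by push_cast; ring
    rw [ascPochhammer_succ_eval, ih, this, Real.Gamma_add_one hn]
    ring

theorem Real.choose_eq_Gamma_div {r : ℝ} (hr : 0 < r) (n : ℕ) :
    Ring.choose (r + n - 1) n = Real.Gamma (n + r) / (n.factorial * Real.Gamma r) := by
  have h := Ring.factorial_nsmul_multichoose_eq_ascPochhammer r n
  rw [Ring.multichoose_eq, Polynomial.ascPochhammer_smeval_eq_eval,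
    Real.ascPochhammer_eval_eq_Gamma_div hr, nsmul_eq_mul] at h
  have hf : (n.factorial : ℝ) ≠ 0 := by positivity
  rw [mul_comm (n.factorial : ℝ), ← div_div, ← h, mul_div_cancel_left₀ _ hf]

/-- The negative binomial series. -/
theorem Real.hasSum_Gamma_div_mul_pow {r x : ℝ} (hr : 0 < r) (hx : |x| < 1) :
    HasSum (fun n : ℕ => Real.Gamma (n + r) / (n.factorial * Real.Gamma r) * x ^ n)
      (1 / (1 - x) ^ r) := by
  have h := (Real.one_div_one_sub_rpow_hasFPowerSeriesOnBall_zero r).hasSum (y := x)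
    (by simpa [enorm_eq_nnnorm, ← NNReal.coe_lt_coe] using! hx)
  simpa [Real.choose_eq_Gamma_div hr, mul_comm, FormalMultilinearSeries.ofScalars] using! h

theorem Real.hasSum_negBinomial {r a : ℝ} (hr : 0 < r) (ha : 0 < a) :
    HasSum (fun k : ℕ => Real.Gamma (k + r) / (k.factorial * Real.Gamma r) * a ^ k /
      (1 + a) ^ ((k : ℝ) + r)) 1 := by
  have ha1 : 0 < 1 + a := by positivity
  have hx : |a / (1 + a)| < 1 := by
    rw [abs_of_pos (by positivity), div_lt_one ha1]
    linarith
  have h1x : 1 - a / (1 + a) = (1 + a)⁻¹ := by field_simp; ring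
  have hpos : 0 < (1 + a) ^ r := Real.rpow_pos_of_pos ha1 r
  have h := (Real.hasSum_Gamma_div_mul_pow hr hx).div_const ((1 + a) ^ r)
  rw [h1x, Real.inv_rpow ha1.le, one_div, inv_inv, div_self hpos.ne'] at h
  convert! h using 1
  funext k
  rw [Real.rpow_add ha1, Real.rpow_natCast, div_pow]
  field_simp

theorem hasSum_negBinomialPMFReal {t θ : ℝ} (ht : 0 < t) (hθ : 0 < θ) :
    HasSum (negBinomialPMFReal t θ) 1 :=
  Real.hasSum_negBinomial (one_div_pos.2 ht) (mul_pos hθ ht)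

theorem hasSum_negBinomialPMFReal_mul {t θ : ℝ} (ht : 0 < t) (hθ : 0 < θ) :
    HasSum (fun k : ℕ => negBinomialPMFReal t θ k * k) θ := by
  have hr : 0 < 1 / t := one_div_pos.2 ht
  have h := (Real.hasSum_negBinomial (add_pos hr one_pos) (mul_pos hθ ht)).mul_left θ
  rw [← hasSum_nat_add_iff' 1]
  simp only [Finset.range_one, Finset.sum_singleton, Nat.cast_zero, mul_zero, sub_zero]
  rw [mul_one] at h
  convert! h using 1
  funext k
  have hG := (Real.Gamma_pos_of_pos hr).ne'
  have he : ((k + 1 : ℕ) : ℝ) + 1 / t = k + (1 / t + 1) := by push_cast; ring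
  have hk : ((k : ℝ) + 1) ≠ 0 := by positivity
  unfold negBinomialPMFReal
  rw [he, Real.Gamma_add_one hr.ne', Nat.factorial_succ, pow_succ]
  push_cast
  generalize Real.Gamma (1 / t) = G at *
  generalize Real.Gamma (k + (1 / t + 1)) = G' at *
  generalize (1 + θ * t) ^ ((k : ℝ) + (1 / t + 1)) = D at *
  field_simp

theorem negBinomialPMFReal_pos {t θ : ℝ} (ht : 0 < t) (hθ : 0 < θ) (k : ℕ) :
    0 < negBinomialPMFReal t θ k := by
  unfold negBinomialPMFReal
  have h1 : 0 < Real.Gamma (1 / t) := Real.Gamma_pos_of_pos (by positivity)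
  have h2 : 0 < Real.Gamma (k + 1 / t) := Real.Gamma_pos_of_pos (by positivity)
  positivity

theorem hasSum_zinb2PMFReal_mul {t θ p : ℝ} {f : ℕ → ℝ} {s : ℝ}
    (h : HasSum (fun k => negBinomialPMFReal t (θ / (1 - p)) k * f k) s) :
    HasSum (fun k => zinb2PMFReal t θ p k * f k) (p * f 0 + (1 - p) * s) := by
  have h0 := hasSum_ite_eq (0 : ℕ) (p * f 0)
  convert! h0.add (h.mul_left (1 - p)) using 1
  funext k
  unfold zinb2PMFReal
  split_ifs with hk
  · subst hk; ring
  · ring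

theorem hasSum_integral_discreteMeasure {w : ℕ → ℝ} (hw : ∀ k, 0 ≤ w k) {f : ℝ → ℝ}
    (hf : Integrable f (discreteMeasure w)) :
    HasSum (fun k : ℕ => w k * f k) (∫ x, f x ∂discreteMeasure w) := by
  have h := hasSum_integral_measure hf
  convert! h using 1
  funext k
  rw [integral_smul_measure, integral_dirac, ENNReal.toReal_ofReal (hw k), smul_eq_mul]

theorem hasSum_integral_ZINB₂ {t θ p : ℝ} (ht : 0 < t) (hθ : 0 < θ) (hp₀ : 0 ≤ p) (hp₁ : p < 1)
    {f : ℝ → ℝ} (hf : Integrable f (ZINB₂ t θ p)) :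
    HasSum (fun k : ℕ => zinb2PMFReal t θ p k * f k) (∫ x, f x ∂ZINB₂ t θ p) := by
  have hq : 0 < 1 - p := sub_pos.2 hp₁
  obtain ⟨hf1, hf2⟩ := integrable_add_measure.1 hf
  have hf3 : Integrable f (negBinomialMeasure t (θ / (1 - p))) :=
    (integrable_smul_measure (by simpa using hp₁) ENNReal.ofReal_ne_top).1 hf2
  have h := hasSum_zinb2PMFReal_mul (f := fun k => f k) (hasSum_integral_discreteMeasure
    (fun k => (negBinomialPMFReal_pos ht (div_pos hθ hq) k).le) hf3)
  convert! h using 1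
  unfold ZINB₂ ziMeasure
  rw [integral_add_measure hf1 hf2, integral_smul_measure, integral_smul_measure, integral_dirac,
    ENNReal.toReal_ofReal hp₀, ENNReal.toReal_ofReal hq.le]
  simp [negBinomialMeasure]

theorem hasSum_zinb2PMFReal {t θ p : ℝ} (ht : 0 < t) (hθ : 0 < θ) (hp : p < 1) :
    HasSum (zinb2PMFReal t θ p) 1 := by
  have hq : 0 < 1 - p := sub_pos.2 hp
  have h := hasSum_zinb2PMFReal_mul (p := p) (f := fun _ => 1) (s := 1)
    (by simpa using! hasSum_negBinomialPMFReal ht (div_pos hθ hq))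
  simpa using h

theorem hasSum_zinb2PMFReal_mul_id {t θ p : ℝ} (ht : 0 < t) (hθ : 0 < θ) (hp : p < 1) :
    HasSum (fun k : ℕ => zinb2PMFReal t θ p k * k) θ := by
  have hq : 0 < 1 - p := sub_pos.2 hp
  have h := hasSum_zinb2PMFReal_mul (p := p) (f := fun k => k)
    (hasSum_negBinomialPMFReal_mul ht (div_pos hθ hq))
  rwa [Nat.cast_zero, mul_zero, zero_add, mul_div_cancel₀ _ hq.ne'] at h

/-- A convex function minus its chord over `[0, b]` is nonpositive inside and nonnegative
outside to the right. -/
theorem ConvexOn.sub_chord_sign {φ : ℝ → ℝ} (hφ : ConvexOn ℝ Set.univ φ) {b x : ℝ} (hb : 0 < b)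
    (hx : 0 < x) :
    (x ≤ b → φ x - φ 0 - (φ b - φ 0) / b * x ≤ 0) ∧
      (b ≤ x → 0 ≤ φ x - φ 0 - (φ b - φ 0) / b * x) := by
  constructor <;> intro h
  · have := hφ.secant_mono (Set.mem_univ 0) (Set.mem_univ x) (Set.mem_univ b) hx.ne' hb.ne' h
    rw [sub_zero, sub_zero, div_le_iff₀ hx] at this
    linarith
  · have := hφ.secant_mono (Set.mem_univ 0) (Set.mem_univ b) (Set.mem_univ x) hb.ne' hx.ne' h
    rw [sub_zero, sub_zero, le_div_iff₀ hx] at this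
    linarith

/-- The cut criterion: two weight functions on `ℕ` with the same mass and mean whose difference
changes sign only once on the positive integers, from nonpositive to nonnegative, are ordered
when integrated against a convex function. -/
theorem ConvexOn.sum_le_sum_of_cut {φ : ℝ → ℝ} (hφ : ConvexOn ℝ Set.univ φ) {u v : ℕ → ℝ}
    {c m A B : ℝ} (hu : HasSum u c) (hv : HasSum v c)
    (hum : HasSum (fun k : ℕ => u k * k) m) (hvm : HasSum (fun k : ℕ => v k * k) m)
    (hA : HasSum (fun k : ℕ => u k * φ k) A) (hB : HasSum (fun k : ℕ => v k * φ k) B)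
    {N : ℕ} (hN : 0 < N) (hlt : ∀ k, 0 < k → k < N → v k ≤ u k) (hge : ∀ k, N ≤ k → u k ≤ v k) :
    A ≤ B := by
  set s := (φ N - φ 0) / N
  have h := ((hB.sub hA).sub ((hv.sub hu).mul_left (φ 0))).sub ((hvm.sub hum).mul_left s)
  have h0 := h.nonneg fun k => ?_
  · linarith
  have key : 0 ≤ (v k - u k) * (φ k - φ 0 - s * k) := by
    rcases Nat.eq_zero_or_pos k with rfl | hk
    · simp
    obtain ⟨h1, h2⟩ := hφ.sub_chord_sign (b := N) (x := k) (by exact_mod_cast hN)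
      (by exact_mod_cast hk)
    rcases lt_or_ge k N with hkN | hkN
    · exact mul_nonneg_of_nonpos_of_nonpos (sub_nonpos.2 (hlt k hk hkN))
        (h1 (by exact_mod_cast hkN.le))
    · exact mul_nonneg (sub_nonneg.2 (hge k hkN)) (h2 (by exact_mod_cast hkN))
  calc (0 : ℝ) ≤ _ := key
    _ = _ := by ring

/-- The ratio of two negative binomial weights with the same `t` is geometric. -/
theorem negBinomialPMFReal_eq_mul {t θ₁ θ₂ : ℝ} (ht : 0 < t) (h₁ : 0 < θ₁) (h₂ : 0 < θ₂) (k : ℕ) :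
    negBinomialPMFReal t θ₂ k = ((1 + θ₁ * t) / (1 + θ₂ * t)) ^ (1 / t) *
      (θ₂ * (1 + θ₁ * t) / (θ₁ * (1 + θ₂ * t))) ^ k * negBinomialPMFReal t θ₁ k := by
  have ha₁ : 0 < 1 + θ₁ * t := by positivity
  have ha₂ : 0 < 1 + θ₂ * t := by positivity
  have hb₁ := Real.rpow_pos_of_pos ha₁ (1 / t)
  have hb₂ := Real.rpow_pos_of_pos ha₂ (1 / t)
  unfold negBinomialPMFReal
  rw [Real.rpow_add ha₁, Real.rpow_add ha₂, Real.rpow_natCast, Real.rpow_natCast,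
    Real.div_rpow ha₁.le ha₂.le]
  generalize (1 + θ₁ * t) ^ (1 / t) = b₁ at *
  generalize (1 + θ₂ * t) ^ (1 / t) = b₂ at *
  generalize 1 + θ₁ * t = a₁ at *
  generalize 1 + θ₂ * t = a₂ at *
  simp only [div_pow, mul_pow]
  field_simp

theorem exists_zinb2PMFReal_cut {t θ p₁ p₂ : ℝ} (ht : 0 < t) (hθ : 0 < θ) (hp₁₂ : p₁ < p₂)
    (hp₂ : p₂ < 1) :
    ∃ N : ℕ, 0 < N ∧
      (∀ k, 0 < k → k < N → zinb2PMFReal t θ p₂ k ≤ zinb2PMFReal t θ p₁ k) ∧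
      ∀ k, N ≤ k → zinb2PMFReal t θ p₁ k ≤ zinb2PMFReal t θ p₂ k := by
  have hq₂ : 0 < 1 - p₂ := by linarith
  have hq₁ : 0 < 1 - p₁ := by linarith
  have hθ₁ : 0 < θ / (1 - p₁) := by positivity
  have hθ₂ : 0 < θ / (1 - p₂) := by positivity
  have hθ₁₂ : θ / (1 - p₁) < θ / (1 - p₂) := div_lt_div_of_pos_left hθ hq₂ (by linarith)
  set θ₁ := θ / (1 - p₁)
  set θ₂ := θ / (1 - p₂)
  set R := θ₂ * (1 + θ₁ * t) / (θ₁ * (1 + θ₂ * t)) with hR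
  set C := (1 - p₂) / (1 - p₁) * ((1 + θ₁ * t) / (1 + θ₂ * t)) ^ (1 / t) with hC
  have hR1 : 1 < R := by
    rw [hR, one_lt_div (by positivity)]
    nlinarith
  have hC0 : 0 < C := by positivity
  have hval : ∀ k, 0 < k → zinb2PMFReal t θ p₂ k = C * R ^ k * zinb2PMFReal t θ p₁ k := by
    intro k hk
    unfold zinb2PMFReal
    rw [if_neg hk.ne', if_neg hk.ne', negBinomialPMFReal_eq_mul ht hθ₁ hθ₂, hC]
    field_simp
    ring
  have hpos : ∀ k, 0 < k → 0 < zinb2PMFReal t θ p₁ k := by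
    intro k hk
    unfold zinb2PMFReal
    rw [if_neg hk.ne', zero_add]
    exact mul_pos hq₁ (negBinomialPMFReal_pos ht hθ₁ k)
  have hex : ∃ N : ℕ, 0 < N ∧ 1 ≤ C * R ^ N := by
    obtain ⟨n, hn⟩ := pow_unbounded_of_one_lt C⁻¹ hR1
    refine ⟨n + 1, n.succ_pos, ?_⟩
    have : C⁻¹ < R ^ (n + 1) := hn.trans (pow_lt_pow_right₀ hR1 n.lt_succ_self)
    exact ((inv_lt_iff_one_lt_mul₀' hC0).1 this).le
  classical
  refine ⟨Nat.find hex, (Nat.find_spec hex).1, fun k hk hkN => ?_, fun k hkN => ?_⟩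
  · have h := Nat.find_min hex hkN
    push Not at h
    rw [hval k hk]
    exact mul_le_of_le_one_left (hpos k hk).le (h hk).le
  · have hk := (Nat.find_spec hex).1.trans_le hkN
    rw [hval k hk]
    refine le_mul_of_one_le_left (hpos k hk).le ((Nat.find_spec hex).2.trans ?_)
    gcongr
    exact hR1.le

/-- For every `t > 0`, `θ > 0` and `0 ≤ p₁ < p₂ < 1`, the zero-inflated
negative binomial distributions of the second kind satisfy `Z₂(t,θ,p₁) ≤cx Z₂(t,θ,p₂)`. -/
theorem zinb2_convexOrder (t θ p₁ p₂ : ℝ) (ht : 0 < t) (hθ : 0 < θ)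
    (hp₁ : 0 ≤ p₁) (hp₁₂ : p₁ < p₂) (hp₂ : p₂ < 1) :
    ConvexOrder (ZINB₂ t θ p₁) (ZINB₂ t θ p₂) := by
  intro φ hφ h₁ h₂
  have hp₁' : p₁ < 1 := hp₁₂.trans hp₂
  obtain ⟨N, hN, hlt, hge⟩ := exists_zinb2PMFReal_cut ht hθ hp₁₂ hp₂
  exact hφ.sum_le_sum_of_cut (hasSum_zinb2PMFReal ht hθ hp₁') (hasSum_zinb2PMFReal ht hθ hp₂)
    (hasSum_zinb2PMFReal_mul_id ht hθ hp₁') (hasSum_zinb2PMFReal_mul_id ht hθ hp₂)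
    (hasSum_integral_ZINB₂ ht hθ hp₁ hp₁' h₁)
    (hasSum_integral_ZINB₂ ht hθ (hp₁.trans hp₁₂.le) hp₂ h₂) hN hlt hge

end
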